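/- arXiv:math/0608212 — 2 statements merged into one kernel-verified Lean document; each statement's English description precedes it below -/
import Mathlib

section
/- Let G be a hyperbolic group with finite generating set Σ. For g ∈ G define the cone type of g as C(g) = {z ∈ G : |gz| = |g| + |z|}. Then the set {C(g) : g ∈ G} of cone types of G is finite. -/
section Preamble

variable {G : Type*} [Group G]

/-- The word length of `g : G` with respect to the generating set `S`. -/
noncomputable def wordLength (S : Set G) (g : G) : ℕ :=
  sInf {n | ∃ w : List G, (∀ x ∈ w, x ∈ S) ∧ w.length = n ∧ w.prod = g}

/-- The word metric `d(x, y) = |x⁻¹ y|` on the Cayley graph of `G`. -/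
noncomputable def wordDist (S : Set G) (x y : G) : ℕ := wordLength S (x⁻¹ * y)

/-- `S` is a finite generating set of `G` closed under inversion. -/
def IsGenSet (S : Set G) : Prop :=
  S.Finite ∧ (∀ x ∈ S, x⁻¹ ∈ S) ∧ Subgroup.closure S = ⊤

/-- `γ`, restricted to `{0, …, n}`, is a geodesic segment in the Cayley graph. -/
def IsGeodesicSegment (S : Set G) (γ : ℕ → G) (n : ℕ) : Prop :=
  ∀ i j, i ≤ n → j ≤ n → wordDist S (γ i) (γ j) = Nat.dist i j

/-- `r : ℕ → G` is a geodesic ray in the Cayley graph. -/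
def IsGeodesicRay (S : Set G) (r : ℕ → G) : Prop :=
  ∀ i j, wordDist S (r i) (r j) = Nat.dist i j

/-- Every geodesic triangle in the Cayley graph of `G` is `δ`-thin: each side lies in
the `δ`-neighborhood of the union of the other two sides. -/
def IsDeltaHyperbolic (S : Set G) (δ : ℕ) : Prop :=
  ∀ (γ₁ γ₂ γ₃ : ℕ → G) (n₁ n₂ n₃ : ℕ),
    IsGeodesicSegment S γ₁ n₁ → IsGeodesicSegment S γ₂ n₂ → IsGeodesicSegment S γ₃ n₃ →
    γ₁ 0 = γ₃ 0 → γ₁ n₁ = γ₂ 0 → γ₂ n₂ = γ₃ n₃ →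
    ∀ k ≤ n₃, ∃ i, (i ≤ n₁ ∧ wordDist S (γ₃ k) (γ₁ i) ≤ δ) ∨
      (i ≤ n₂ ∧ wordDist S (γ₃ k) (γ₂ i) ≤ δ)

/-- `G` is hyperbolic with respect to `S`: some `δ` makes all triangles `δ`-thin. -/
def IsHyperbolic (S : Set G) : Prop := ∃ δ : ℕ, IsDeltaHyperbolic S δ

/-- `H` is a `K`-quasiconvex subgroup: every geodesic between points of `H`
lies in the `K`-neighborhood of `H`. -/
def IsQuasiconvex (S : Set G) (H : Subgroup G) (K : ℕ) : Prop :=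
  ∀ (γ : ℕ → G) (n : ℕ), IsGeodesicSegment S γ n → γ 0 ∈ H → γ n ∈ H →
    ∀ i ≤ n, ∃ h ∈ H, wordDist S (γ i) h ≤ K

/-- Property (*): there is a set-theoretic section `s : G/H → G` of the coset
projection whose image is a net in `G` for the word metric of `S`. -/
def SatisfiesStar (S : Set G) (H : Subgroup G) : Prop :=
  ∃ s : G ⧸ H → G, (∀ q : G ⧸ H, (QuotientGroup.mk (s q) : G ⧸ H) = q) ∧
    ∃ C : ℕ, ∀ g : G, ∃ q : G ⧸ H, wordDist S g (s q) ≤ C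

/-- A hyperbolic group is elementary if it is finite or has an infinite cyclic
subgroup of finite index. -/
def IsElementary (G : Type*) [Group G] : Prop :=
  Finite G ∨ ∃ H : Subgroup G, IsCyclic H ∧ Infinite H ∧ H.index ≠ 0

end Preamble

section Helpers

variable {G : Type*} [Group G] {S : Set G}

theorem wl_exists (h : IsGenSet S) (g : G) :
    ∃ w : List G, (∀ x ∈ w, x ∈ S) ∧ w.length = wordLength S g ∧ w.prod = g := by
  have hne : {n | ∃ w : List G, (∀ x ∈ w, x ∈ S) ∧ w.length = n ∧ w.prod = g}.Nonempty := by
    have hg : g ∈ Subgroup.closure S := by rw [h.2.2]; trivial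
    rw [← Subgroup.mem_toSubmonoid, Subgroup.closure_toSubmonoid] at hg
    obtain ⟨l, hl, hp⟩ := Submonoid.exists_list_of_mem_closure hg
    refine ⟨l.length, l, fun x hx => ?_, rfl, hp⟩
    rcases hl x hx with h1 | h1
    · exact h1
    · simpa using h.2.1 _ h1
  exact Nat.sInf_mem hne

theorem wl_le (w : List G) (hw : ∀ x ∈ w, x ∈ S) : wordLength S w.prod ≤ w.length :=
  Nat.sInf_le ⟨w, hw, rfl, rfl⟩

theorem wl_one : wordLength S (1 : G) = 0 := by
  have := wl_le (S := S) ([] : List G) (by simp)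
  simpa using this

theorem wl_mul (h : IsGenSet S) (a b : G) :
    wordLength S (a * b) ≤ wordLength S a + wordLength S b := by
  obtain ⟨u, hu, hul, hup⟩ := wl_exists h a
  obtain ⟨v, hv, hvl, hvp⟩ := wl_exists h b
  have := wl_le (S := S) (u ++ v) (by
    intro x hx
    rcases List.mem_append.1 hx with h1 | h1
    · exact hu x h1
    · exact hv x h1)
  rw [List.prod_append, hup, hvp, List.length_append, hul, hvl] at this
  exact this

theorem wl_inv_le (h : IsGenSet S) (a : G) : wordLength S a⁻¹ ≤ wordLength S a := by
  obtain ⟨u, hu, hul, hup⟩ := wl_exists h a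
  have := wl_le (S := S) (u.map (·⁻¹)).reverse (by
    intro x hx
    simp only [List.mem_reverse, List.mem_map] at hx
    obtain ⟨y, hy, rfl⟩ := hx
    exact h.2.1 _ (hu y hy))
  rw [← List.prod_inv_reverse, hup] at this
  simpa [hul] using this

theorem wl_inv (h : IsGenSet S) (a : G) : wordLength S a⁻¹ = wordLength S a := by
  apply le_antisymm (wl_inv_le h a)
  simpa using wl_inv_le h a⁻¹

theorem wd_comm (h : IsGenSet S) (a b : G) : wordDist S a b = wordDist S b a := by
  unfold wordDist
  rw [← wl_inv h]; simp

theorem wd_tri (h : IsGenSet S) (a b c : G) :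
    wordDist S a c ≤ wordDist S a b + wordDist S b c := by
  unfold wordDist
  have := wl_mul h (a⁻¹ * b) (b⁻¹ * c)
  simpa [mul_assoc] using this

theorem wd_one (a : G) : wordDist S 1 a = wordLength S a := by
  simp [wordDist]

theorem geo_aux (h : IsGenSet S) (x : G) (w : List G) (hw : ∀ y ∈ w, y ∈ S)
    (hl : w.length = wordLength S w.prod) (i j : ℕ) (hij : i ≤ j) (hj : j ≤ w.length) :
    wordDist S (x * (w.take i).prod) (x * (w.take j).prod) = j - i := by
  have e1 : (w.take j).prod = (w.take i).prod * ((w.take j).drop i).prod := by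
    rw [← List.prod_append]
    congr 1
    have := List.take_append_drop i (w.take j)
    rw [List.take_take, min_eq_left hij] at this
    exact this.symm
  have e2 : w.prod = (w.take j).prod * (w.drop j).prod := by
    rw [← List.prod_append, List.take_append_drop]
  have e3 : wordDist S (x * (w.take i).prod) (x * (w.take j).prod)
      = wordLength S ((w.take j).drop i).prod := by
    unfold wordDist; rw [e1]; congr 1; group
  rw [e3]
  have a1 := wl_le (S := S) ((w.take j).drop i)
    (fun y hy => hw y (List.mem_of_mem_take (List.mem_of_mem_drop hy)))
  have a2 := wl_le (S := S) (w.take i) (fun y hy => hw y (List.mem_of_mem_take hy))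
  have a3 := wl_le (S := S) (w.drop j) (fun y hy => hw y (List.mem_of_mem_drop hy))
  have a4 := wl_mul h (w.take j).prod (w.drop j).prod
  have a5 := wl_mul h (w.take i).prod ((w.take j).drop i).prod
  rw [← e2] at a4
  rw [← e1] at a5
  simp only [List.length_drop, List.length_take] at a1 a2 a3
  omega

theorem geo (h : IsGenSet S) (x : G) (w : List G) (hw : ∀ y ∈ w, y ∈ S)
    (hl : w.length = wordLength S w.prod) :
    IsGeodesicSegment S (fun i => x * (w.take i).prod) w.length := by
  intro i j hi hj
  rcases le_total i j with hij | hij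
  · rw [geo_aux h x w hw hl i j hij hj, Nat.dist_eq_sub_of_le hij]
  · rw [wd_comm h, geo_aux h x w hw hl j i hij hi, Nat.dist_comm, Nat.dist_eq_sub_of_le hij]

theorem ball_finite (h : IsGenSet S) (k : ℕ) : {g : G | wordLength S g ≤ k}.Finite := by
  have : Finite S := h.1
  have hf := (List.finite_length_le S k).image (fun l => (l.map Subtype.val).prod)
  refine hf.subset ?_
  intro g hg
  obtain ⟨w, hw, hl, hp⟩ := wl_exists h g
  refine ⟨w.attach.map (fun x => ⟨x.1, hw _ x.2⟩), ?_, ?_⟩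
  · simp only [Set.mem_ofPred_eq, List.length_map, List.length_attach] at hg ⊢
    omega
  · simp [List.map_map, Function.comp_def, hp]

/-- The tail of `g`: short elements that bring `g` closer to the identity. -/
def tailSet (S : Set G) (k : ℕ) (g : G) : Set G :=
  {a | wordLength S a ≤ k ∧ wordLength S (g * a) < wordLength S g}

theorem cone_sub (h : IsGenSet S) {δ : ℕ} (hd : IsDeltaHyperbolic S δ) (g g' : G)
    (hT : tailSet S (2 * δ + 3) g = tailSet S (2 * δ + 3) g') (n : ℕ) :
    ∀ z : G, wordLength S z = n → wordLength S (g * z) = wordLength S g + wordLength S z →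
      wordLength S (g' * z) = wordLength S g' + wordLength S z := by
  induction n with
  | zero =>
    intro z hz _
    obtain ⟨w, hw, hl, hp⟩ := wl_exists h z
    rw [hz, List.length_eq_zero_iff] at hl
    subst hl
    simp only [List.prod_nil] at hp
    subst hp
    simp [wl_one]
  | succ n ih =>
    intro z hz hgz
    by_contra hne
    obtain ⟨wz, hwz, hlz, hpz⟩ := wl_exists h z
    have hgeoz := geo h 1 wz hwz (by rw [hpz, hlz])
    obtain ⟨y, hy⟩ : ∃ y, y = (wz.take n).prod := ⟨_, rfl⟩
    have hyl : wordLength S y = n := by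
      have := geo_aux h 1 wz hwz (by rw [hpz, hlz]) 0 n (by omega) (by omega)
      simpa [wd_one, ← hy] using this
    have hyz : wordLength S (y⁻¹ * z) = 1 := by
      have := geo_aux h 1 wz hwz (by rw [hpz, hlz]) n wz.length (by omega) (by omega)
      simp only [one_mul, List.take_length, hpz, ← hy, wordDist] at this
      omega
    have hgy : wordLength S (g * y) = wordLength S g + wordLength S y := by
      have a1 := wl_mul h g y
      have a2 := wl_mul h (g * y) (y⁻¹ * z)
      have e : g * y * (y⁻¹ * z) = g * z := by group
      rw [e] at a2
      omega
    have hgy' := ih y hyl hgy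
    have hle := wl_mul h g' z
    obtain ⟨wg, hwg, hlg, hpg⟩ := wl_exists h g'
    obtain ⟨wy, hwy, hly, hpy⟩ := wl_exists h y
    have g3 := geo h 1 (wg ++ wy) (by
      intro x hx
      rcases List.mem_append.1 hx with h1 | h1
      · exact hwg x h1
      · exact hwy x h1) (by
      rw [List.prod_append, List.length_append, hpg, hpy, hgy', hlg, hly])
    obtain ⟨u, hu, hlu, hpu⟩ := wl_exists h (g' * z)
    have hlu' : u.length = wordLength S u.prod := by rw [hpu, hlu]
    have g1 := geo h 1 u hu hlu'
    obtain ⟨e, he, hle', hpe⟩ := wl_exists h ((g' * z)⁻¹ * (g' * y))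
    have g2 := geo h (g' * z) e he (by rw [hpe, hle'])
    have hel : e.length = 1 := by
      rw [hle', ← wl_inv h, ← hyz]; congr 1; group
    obtain ⟨i, hi⟩ := hd _ _ _ _ _ _ g1 g2 g3 (by simp) (by simp [hpu])
      (by
        simp only [List.take_length, List.prod_append, hpe, hpg, hpy, one_mul, mul_inv_cancel_left]) wg.length (by simp)
    have key : ∃ p ≤ u.length, wordDist S g' (u.take p).prod ≤ δ + 1 := by
      rcases hi with ⟨hi1, hi2⟩ | ⟨hi1, hi2⟩
      · refine ⟨i, hi1, ?_⟩
        simp only [one_mul, List.take_left, hpg] at hi2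
        omega
      · refine ⟨u.length, le_rfl, ?_⟩
        rw [List.take_length, hpu]
        simp only [one_mul, List.take_left, hpg] at hi2
        have b1 := g2 i 0 hi1 (by omega)
        simp only [List.take_zero, List.prod_nil, mul_one, Nat.dist_zero_right] at b1
        have b2 := wd_tri h g' (g' * z * (e.take i).prod) (g' * z)
        omega
    obtain ⟨p, hp, hpd⟩ := key
    have hpl : wordLength S (u.take p).prod = p := by
      have := geo_aux h 1 u hu hlu' 0 p (by omega) hp
      simpa [wd_one] using this
    have c1 := wd_tri h 1 g' (u.take p).prod
    have c2 := wd_tri h 1 (u.take p).prod g'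
    rw [wd_comm h (u.take p).prod g'] at c2
    simp only [wd_one] at c1 c2
    rw [hpl] at c1 c2
    have hul : wordLength S (g' * y) ≤ wordLength S (g' * z) + 1 := by
      have := wl_mul h (g' * z) ((g' * z)⁻¹ * (g' * y))
      rw [mul_inv_cancel_left] at this
      omega
    have hpos : 0 < wordLength S g' := by
      rcases Nat.eq_zero_or_pos (wordLength S g') with h0 | h0
      · exfalso
        apply hne
        rw [h0, List.length_eq_zero_iff] at hlg
        subst hlg
        simp only [List.prod_nil] at hpg
        subst hpg
        simp [wl_one]
      · exact h0
    obtain ⟨m, hm⟩ : ∃ m, m + 1 = wordLength S g' := ⟨wordLength S g' - 1, by omega⟩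
    have hmu : m ≤ u.length := by omega
    have hvl : wordLength S (u.take m).prod = m := by
      have := geo_aux h 1 u hu hlu' 0 m (by omega) hmu
      simpa [wd_one] using this
    have hvw : (u.take m).prod * (u.drop m).prod = g' * z := by
      rw [← List.prod_append, List.take_append_drop, hpu]
    have hwl := wl_le (S := S) (u.drop m) (fun y hy => hu y (List.mem_of_mem_drop hy))
    rw [List.length_drop] at hwl
    have hpv : wordDist S (u.take p).prod (u.take m).prod ≤ δ + 2 := by
      rcases le_total p m with hpm | hpm
      · have := geo_aux h 1 u hu hlu' p m hpm hmu
        simp only [one_mul] at this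
        omega
      · have := geo_aux h 1 u hu hlu' m p hpm hp
        simp only [one_mul] at this
        rw [wd_comm h]
        omega
    have hd1 := wd_tri h g' (u.take p).prod (u.take m).prod
    have hmem : g'⁻¹ * (u.take m).prod ∈ tailSet S (2 * δ + 3) g' := by
      refine ⟨?_, ?_⟩
      · change wordDist S g' (u.take m).prod ≤ _
        omega
      · rw [mul_inv_cancel_left]; omega
    rw [← hT] at hmem
    have f1 := hmem.2
    have f2 := wl_mul h (g * (g'⁻¹ * (u.take m).prod)) (u.drop m).prod
    have f3 : g * (g'⁻¹ * (u.take m).prod) * (u.drop m).prod = g * z := by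
      rw [mul_assoc, mul_assoc, hvw, inv_mul_cancel_left]
    rw [f3] at f2
    omega

end Helpers

/-- (Cannon) A hyperbolic group has finitely many cone types, where
the cone type of `g` is `{z : |gz| = |g| + |z|}`. -/
theorem statement_15 {G : Type*} [Group G] (S : Set G) (hGen : IsGenSet S)
    (hHyp : IsHyperbolic S) :
    {C : Set G | ∃ g : G,
      C = {z : G | wordLength S (g * z) = wordLength S g + wordLength S z}}.Finite := by
  obtain ⟨δ, hd⟩ := hHyp
  have hfin : (Set.range (tailSet S (2 * δ + 3))).Finite := by
    refine (ball_finite hGen (2 * δ + 3)).finite_subsets.subset ?_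
    rintro _ ⟨g, rfl⟩ a ha
    exact ha.1
  refine (hfin.image (fun t => {z : G |
    wordLength S (Function.invFun (tailSet S (2 * δ + 3)) t * z) =
      wordLength S (Function.invFun (tailSet S (2 * δ + 3)) t) + wordLength S z})).subset ?_
  rintro _ ⟨g, rfl⟩
  refine ⟨_, ⟨g, rfl⟩, ?_⟩
  have hinv : tailSet S (2 * δ + 3)
      (Function.invFun (tailSet S (2 * δ + 3)) (tailSet S (2 * δ + 3) g)) =
      tailSet S (2 * δ + 3) g := Function.invFun_eq ⟨g, rfl⟩
  ext z
  exact ⟨cone_sub hGen hd _ _ hinv _ z rfl, cone_sub hGen hd _ _ hinv.symm _ z rfl⟩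
end

section
/- Let G be a non-elementary hyperbolic group. Then G contains a nonabelian free subgroup (in particular, a free subgroup of rank 2). -/
section Helpers

variable {G : Type*} [Group G]

/-- An abstract hyperbolic length function on a group. -/
structure HypLen (l : G → ℤ) (K : ℤ) : Prop where
  K_nonneg : 0 ≤ K
  one : l 1 = 0
  inv : ∀ x, l x⁻¹ = l x
  mul_le : ∀ x y, l (x * y) ≤ l x + l y
  nonneg : ∀ x, 0 ≤ l x
  four : ∀ x y z w, l (x⁻¹ * z) + l (y⁻¹ * w) ≤
    max (l (x⁻¹ * y) + l (z⁻¹ * w)) (l (y⁻¹ * z) + l (x⁻¹ * w)) + K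
  ball : ∀ R : ℤ, {x | l x ≤ R}.Finite

/-- Twice the Gromov product based at the identity. -/
def gp (l : G → ℤ) (x y : G) : ℤ := l x + l y - l (x⁻¹ * y)

/-- A sufficient condition for being loxodromic. -/
def Lox (l : G → ℤ) (K : ℤ) (g : G) : Prop := gp l g g⁻¹ + 2 * K < l g

namespace HypLen

variable {l : G → ℤ} {K : ℤ}

lemma gp_symm (h : HypLen l K) (x y : G) : gp l x y = gp l y x := by
  have := h.inv (x⁻¹ * y)
  simp only [mul_inv_rev, inv_inv] at this
  simp only [gp]; omega

lemma gp_nonneg (h : HypLen l K) (x y : G) : 0 ≤ gp l x y := by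
  have := h.mul_le x⁻¹ y
  have := h.inv x
  simp only [gp]; omega

lemma gp_le_left (h : HypLen l K) (x y : G) : gp l x y ≤ 2 * l x := by
  have := h.mul_le x (x⁻¹ * y)
  rw [mul_inv_cancel_left] at this
  simp only [gp]; omega

lemma gp_le_right (h : HypLen l K) (x y : G) : gp l x y ≤ 2 * l y := by
  rw [h.gp_symm]; exact h.gp_le_left y x

lemma gp_one (h : HypLen l K) (x : G) : gp l x 1 = 0 := by
  have := h.inv x
  have := h.one
  simp only [gp, mul_one]; omega

lemma gp_four (h : HypLen l K) (x y z : G) : gp l x y ≤ gp l x z + K ∨ gp l y z ≤ gp l x z + K := by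
  have := h.four 1 x y z
  simp only [inv_one, one_mul] at this
  simp only [gp]; omega

lemma gp_shift (h : HypLen l K) (x y : G) : gp l x (x * y) = 2 * l x - gp l x⁻¹ y := by
  have := h.inv x
  simp only [gp, inv_inv, inv_mul_cancel_left]; omega

lemma len_mul (x y : G) (h : HypLen l K) : l (x * y) = l x + l y - gp l x⁻¹ y := by
  have := h.inv x
  simp only [gp, inv_inv]; omega

lemma gp_mul_right (h : HypLen l K) (x y z : G) : gp l x (y * z) ≤ gp l x y + 2 * l z := by
  have h1 := h.mul_le y z
  have h2 := h.mul_le (x⁻¹ * (y * z)) z⁻¹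
  have h3 := h.inv z
  have : x⁻¹ * (y * z) * z⁻¹ = x⁻¹ * y := by group
  rw [this] at h2
  simp only [gp]; omega

/-! ### Powers of a loxodromic element -/

lemma lox_inv (h : HypLen l K) {g : G} (hg : Lox l K g) : Lox l K g⁻¹ := by
  have h1 := h.gp_symm g g⁻¹
  have h2 := h.inv g
  simp only [Lox, inv_inv] at *; omega

lemma lox_pow1 (h : HypLen l K) {g : G} (hg : Lox l K g) (n : ℕ) :
    gp l g⁻¹ (g ^ n) ≤ gp l g g⁻¹ + K := by
  have hK := h.K_nonneg
  have h1 := h.gp_symm g g⁻¹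
  have h0 := h.gp_nonneg g g⁻¹
  induction n with
  | zero => rw [pow_zero, h.gp_one]; omega
  | succ n ih =>
    have h2 := h.gp_shift g (g ^ n)
    rw [← pow_succ'] at h2
    have h3 := h.gp_four g⁻¹ (g ^ (n + 1)) g
    have h4 := h.gp_symm g (g ^ (n + 1))
    simp only [Lox] at hg
    omega

lemma lox_grow (h : HypLen l K) {g : G} (hg : Lox l K g) (n : ℕ) : (n : ℤ) ≤ l (g ^ n) := by
  have hK := h.K_nonneg
  induction n with
  | zero => simp [h.one]
  | succ n ih =>
    have h1 := h.lox_pow1 hg n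
    have h2 := h.len_mul g (g ^ n)
    rw [← pow_succ'] at h2
    simp only [Lox] at hg
    push_cast
    omega

lemma lox_pow2 (h : HypLen l K) {g : G} (hg : Lox l K g) (m n : ℕ) :
    gp l (g⁻¹ ^ m) (g ^ n) ≤ gp l g g⁻¹ + 2 * K := by
  have hK := h.K_nonneg
  have h0 := h.gp_nonneg g g⁻¹
  cases n with
  | zero => rw [pow_zero, h.gp_one]; omega
  | succ k =>
    have h1 := h.lox_pow1 hg k
    have h2 := h.gp_shift g (g ^ k)
    rw [← pow_succ'] at h2
    have h3 := h.lox_pow1 (h.lox_inv hg) m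
    rw [inv_inv] at h3
    have h4 := h.gp_symm g (g⁻¹ ^ m)
    have h5 := h.gp_symm g⁻¹ g
    have h6 := h.gp_four (g⁻¹ ^ m) (g ^ (k + 1)) g
    have h7 := h.gp_symm g (g ^ (k + 1))
    simp only [Lox] at hg
    omega

lemma lox_between (h : HypLen l K) {g : G} (hg : Lox l K g) {m n : ℕ} (hmn : m ≤ n) :
    2 * l (g ^ m) - (gp l g g⁻¹ + 2 * K) ≤ gp l (g ^ m) (g ^ n) := by
  obtain ⟨k, rfl⟩ := Nat.exists_eq_add_of_le hmn
  rw [pow_add, h.gp_shift, ← inv_pow]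
  have := h.lox_pow2 hg m k
  omega

lemma ivt (h : HypLen l K) (g : G) (t : ℤ) (ht : 0 ≤ t) (n : ℕ) (hn : t ≤ l (g ^ n)) :
    ∃ m ≤ n, t ≤ l (g ^ m) ∧ l (g ^ m) ≤ t + l g := by
  have := h.nonneg g
  induction n with
  | zero =>
    rw [pow_zero, h.one] at hn
    exact ⟨0, le_rfl, by rw [pow_zero, h.one]; omega, by rw [pow_zero, h.one]; omega⟩
  | succ n ih =>
    by_cases h1 : t ≤ l (g ^ n)
    · obtain ⟨m, hm, h2⟩ := ih h1
      exact ⟨m, by omega, h2⟩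
    · refine ⟨n + 1, le_rfl, hn, ?_⟩
      have := h.mul_le (g ^ n) g
      rw [← pow_succ] at this
      omega

lemma ivt_int (h : HypLen l K) {g : G} (hg : Lox l K g) (t : ℤ) (ht : 0 ≤ t) (i : ℤ)
    (hi : t ≤ l (g ^ i)) :
    ∃ j : ℤ, t ≤ l (g ^ j) ∧ l (g ^ j) ≤ t + l g ∧
      2 * t - (gp l g g⁻¹ + 2 * K) ≤ gp l (g ^ j) (g ^ i) := by
  obtain ⟨n, rfl | rfl⟩ := i.eq_nat_or_neg
  · rw [zpow_natCast] at *
    obtain ⟨m, hm, h1, h2⟩ := h.ivt g t ht n hi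
    refine ⟨m, ?_⟩
    rw [zpow_natCast]
    have := h.lox_between hg hm
    exact ⟨h1, h2, by omega⟩
  · rw [zpow_neg, zpow_natCast, ← inv_pow] at *
    obtain ⟨m, hm, h1, h2⟩ := h.ivt g⁻¹ t ht n hi
    refine ⟨-m, ?_⟩
    rw [zpow_neg, zpow_natCast, ← inv_pow]
    have h3 := h.lox_between (h.lox_inv hg) hm
    rw [inv_inv] at h3
    have h5 := h.gp_symm g⁻¹ g
    have h6 := h.inv g
    exact ⟨h1, by omega, by omega⟩

lemma lox_abs (h : HypLen l K) {g : G} (hg : Lox l K g) (i : ℤ) : |i| ≤ l (g ^ i) := by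
  obtain ⟨n, rfl | rfl⟩ := i.eq_nat_or_neg
  · have := h.lox_grow hg n
    simpa using this
  · have := h.lox_grow hg n
    simpa [h.inv] using this

lemma lox_inj (h : HypLen l K) {g : G} (hg : Lox l K g) (i : ℤ) (hi : g ^ i = 1) : i = 0 := by
  have := h.lox_abs hg i
  rw [hi, h.one] at this
  exact abs_nonpos_iff.mp this

/-! ### Existence of a loxodromic element -/

lemma exists_lox (h : HypLen l K) (hx : ∀ n : ℕ, ∃ x y, l x = n ∧ l y = n ∧ l (x⁻¹ * y) = 2 * n) :
    ∃ g, Lox l K g := by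
  have hK := h.K_nonneg
  obtain ⟨x, y, h1, h2, h3⟩ := hx (10 * K.toNat + 1)
  push_cast at h1 h2 h3
  rw [Int.toNat_of_nonneg hK] at h1 h2 h3
  by_cases hX : Lox l K x
  · exact ⟨x, hX⟩
  by_cases hY : Lox l K y
  · exact ⟨y, hY⟩
  refine ⟨x * y, ?_⟩
  simp only [Lox, not_lt] at *
  have hxy : gp l x y = 0 := by simp only [gp]; omega
  have a1 : gp l x⁻¹ y ≤ K := by
    have := h.gp_four x x⁻¹ y
    omega
  have a2 : gp l y⁻¹ x ≤ K := by
    have := h.gp_four x y⁻¹ y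
    have := h.gp_symm y⁻¹ y
    have := h.gp_symm y⁻¹ x
    omega
  have e1 := h.len_mul x y
  have e2 := h.len_mul (x * y) x
  have e3 := h.len_mul (x * y * x) y
  -- chain
  have b1 : gp l (x * y)⁻¹ x ≤ 2 * K := by
    have c1 := h.gp_shift y⁻¹ x⁻¹
    rw [← mul_inv_rev, inv_inv, h.inv] at c1
    have c2 := h.gp_symm y x⁻¹
    have c3 := h.gp_four y⁻¹ (x * y)⁻¹ x
    omega
  have b2 : gp l (x * y * x)⁻¹ y ≤ 2 * K := by
    have c1 := h.gp_shift x⁻¹ (x * y)⁻¹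
    rw [← mul_inv_rev, inv_inv, h.inv] at c1
    have c2 := h.gp_symm x (x * y)⁻¹
    have c3 := h.gp_four x⁻¹ (x * y * x)⁻¹ y
    omega
  have e4 : gp l (x * y) (x * y)⁻¹ = l (x * y) + l (x * y) - l (x * y * x * y) := by
    have c1 := h.inv (x * y)
    have c2 := h.inv (x * y * x * y)
    have : (x * y)⁻¹ * (x * y)⁻¹ = (x * y * x * y)⁻¹ := by group
    simp only [gp, this]; omega
  omega

/-! ### The non-commensurating case -/

lemma close_pair (h : HypLen l K) {g : G} (hg : Lox l K g) (s : G) (t : ℤ) (ht : 0 ≤ t) (i j : ℤ)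
    (hP : 2 * t + 2 * l s ≤ gp l (g ^ i) (s * g ^ j)) :
    ∃ i' j' : ℤ, t ≤ l (g ^ i') ∧
      l ((g ^ i')⁻¹ * (s * g ^ j')) ≤
        4 * l s + 2 * l g + gp l g g⁻¹ + 4 * K := by
  have hK := h.K_nonneg
  have hs := h.nonneg s
  have a1 := h.gp_le_left (g ^ i) (s * g ^ j)
  have a2 := h.gp_le_right (g ^ i) (s * g ^ j)
  have a3 := h.mul_le s (g ^ j)
  obtain ⟨i', b1, b2, b3⟩ := h.ivt_int hg t ht i (by omega)
  obtain ⟨j', c1, c2, c3⟩ := h.ivt_int hg t ht j (by omega)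
  refine ⟨i', j', b1, ?_⟩
  have d1 : gp l (g ^ j') (g ^ j) - 2 * l s ≤ gp l (s * g ^ j') (s * g ^ j) := by
    have e1 := h.mul_le s⁻¹ (s * g ^ j)
    have e2 := h.mul_le s⁻¹ (s * g ^ j')
    have e3 := h.inv s
    rw [inv_mul_cancel_left] at e1 e2
    have : (s * g ^ j')⁻¹ * (s * g ^ j) = (g ^ j')⁻¹ * g ^ j := by group
    simp only [gp, this]; omega
  have d2 := h.gp_four (g ^ i') (g ^ i) (s * g ^ j')
  have d3 := h.gp_four (g ^ i) (s * g ^ j) (s * g ^ j')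
  have d4 := h.gp_symm (s * g ^ j') (s * g ^ j)
  have d5 := h.mul_le s (g ^ j')
  have d6 : l ((g ^ i')⁻¹ * (s * g ^ j')) = l (g ^ i') + l (s * g ^ j')
    - gp l (g ^ i') (s * g ^ j') := by simp only [gp]; omega
  have d7 := h.gp_nonneg g g⁻¹
  omega

lemma bounded_of_noncomm (h : HypLen l K) {g : G} (hg : Lox l K g) (s : G)
    (hs : ∀ p q : ℤ, s * g ^ q * s⁻¹ = g ^ p → q = 0) :
    ∃ c : ℤ, ∀ i j : ℤ, gp l (g ^ i) (s * g ^ j) ≤ c := by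
  set R := 4 * l s + 2 * l g + gp l g g⁻¹ + 4 * K with hR
  have hfin : {p : ℤ × ℤ | l ((g ^ p.1)⁻¹ * (s * g ^ p.2)) ≤ R}.Finite := by
    refine Set.Finite.of_finite_image (f := fun p : ℤ × ℤ => (g ^ p.1)⁻¹ * (s * g ^ p.2))
      ((h.ball R).subset ?_) ?_
    · rintro _ ⟨p, hp, rfl⟩
      exact hp
    · rintro ⟨i, j⟩ _ ⟨i', j'⟩ _ he
      simp only at he
      have e1 : s * g ^ (j - j') * s⁻¹ = g ^ (i - i') := by
        rw [zpow_sub, zpow_sub]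
        have : s * g ^ j = g ^ i * ((g ^ i')⁻¹ * (s * g ^ j')) := by
          rw [← he]; group
        rw [← mul_assoc, this]; group
      have e2 := hs _ _ e1
      rw [e2, zpow_zero, mul_one, mul_inv_cancel] at e1
      have e3 := h.lox_inj hg _ e1.symm
      ext <;> simp <;> omega
  obtain ⟨M, hM⟩ := (hfin.image (fun p : ℤ × ℤ => l (g ^ p.1))).bddAbove
  refine ⟨2 * (max M 0 + 1) + 2 * l s, fun i j => ?_⟩
  by_contra hc
  obtain ⟨i', j', h1, h2⟩ := h.close_pair hg s (max M 0 + 1) (by omega) i j (by omega)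
  have := hM ⟨(i', j'), h2, rfl⟩
  simp only at this
  omega

/-! ### The commensurating case -/

lemma min_gp (h : HypLen l K) {g : G} (hg : Lox l K g) (s : G) (hs : ∀ i : ℤ, l s ≤ l (g ^ i * s))
    (i : ℤ) : gp l s (g ^ i) ≤ 2 * (gp l g g⁻¹ + 3 * K + l g + 1) := by
  have hK := h.K_nonneg
  have h0 := h.gp_nonneg g g⁻¹
  have h0' := h.nonneg g
  by_contra hc
  set t := gp l g g⁻¹ + 3 * K + l g + 1 with ht
  have a2 := h.gp_le_right s (g ^ i)
  obtain ⟨j, b1, b2, b3⟩ := h.ivt_int hg t (by omega) i (by omega)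
  have d1 := h.gp_four s (g ^ i) (g ^ j)
  have d2 := h.gp_symm (g ^ i) (g ^ j)
  have d3 := hs (-j)
  have d4 := h.gp_symm s (g ^ j)
  have d5 : gp l (g ^ j) s = l (g ^ j) + l s - l (g ^ (-j) * s) := by
    simp only [gp, zpow_neg]
  omega

lemma comm_bound (h : HypLen l K) {g : G} (hg : Lox l K g) (s : G)
    (hs1 : ∀ i : ℤ, l s ≤ l (g ^ i * s)) (hs2 : ∀ i : ℤ, l s ≤ l (s * g ^ i))
    (p q : ℤ) (hq : q ≠ 0) (he : s * g ^ q * s⁻¹ = g ^ p) :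
    l s ≤ 2 * (gp l g g⁻¹ + 3 * K + l g + 1) + K := by
  have hK := h.K_nonneg
  set C := 2 * (gp l g g⁻¹ + 3 * K + l g + 1) with hC
  have h0 := h.gp_nonneg g g⁻¹
  have h0' := h.nonneg g
  set k := 2 * C + K + 1 with hk
  have hcomm : s * g ^ (q * k) = g ^ (p * k) * s := by
    rw [zpow_mul g p, ← he, conj_zpow, ← zpow_mul]; group
  set u := g ^ (p * k) with hu
  set v := g ^ (q * k) with hv
  have hvl : k ≤ l v := by
    have := h.lox_abs hg (q * k)
    rw [abs_mul] at this
    have h1 : 1 ≤ |q| := Int.one_le_abs hq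
    have h2 : k ≤ |k| := le_abs_self k
    nlinarith
  have hul := h.nonneg u
  have a1 : gp l s u ≤ C := h.min_gp hg s hs1 _
  have a2 : gp l s⁻¹ v ≤ C := by
    refine h.min_gp hg s⁻¹ (fun i => ?_) _
    have := hs2 (-i)
    rw [h.inv]
    rw [← h.inv (g ^ i * s⁻¹)]
    simpa using this
  have b1 := h.len_mul s v
  have b2 : gp l s u = l s + l u - l (s⁻¹ * u) := rfl
  have f := h.four 1 s (s * v) u
  simp only [inv_one, one_mul] at f
  have f1 : l ((s * v)⁻¹ * u) = l s := by
    rw [hcomm, ← h.inv s]; congr 1; group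
  have f2 : s⁻¹ * (s * v) = v := by group
  rw [f1, f2] at f
  omega

lemma finite_index (h : HypLen l K) {g : G} (hg : Lox l K g)
    (hs : ∀ s : G, ∃ p q : ℤ, s * g ^ q * s⁻¹ = g ^ p ∧ q ≠ 0) :
    IsElementary G := by
  right
  refine ⟨Subgroup.zpowers g, inferInstance, ?_, ?_⟩
  · have hinj : Function.Injective (fun i : ℤ =>
        (⟨g ^ i, Subgroup.zpow_mem_zpowers g i⟩ : Subgroup.zpowers g)) := by
      intro i j hij
      have e : g ^ i = g ^ j := congrArg Subtype.val hij
      have := h.lox_inj hg (i - j) (by rw [zpow_sub, e, mul_inv_cancel])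
      omega
    exact Infinite.of_injective _ hinj
  · choose p q he hq using hs
    set D := 2 * (gp l g g⁻¹ + 3 * K + l g + 1) + K with hD
    let F : Set G := ⋃ s ∈ {x | l x ≤ D}, (fun j : ℤ => (s * g ^ j)⁻¹) '' (Set.Icc 0 |q s|)
    have hF : F.Finite := (h.ball D).biUnion fun s _ => (Set.finite_Icc _ _).image _
    have hsurj : ∀ y : G ⧸ Subgroup.zpowers g, y ∈ (fun x : G => (x : G ⧸ Subgroup.zpowers g)) '' F := by
      intro y
      obtain ⟨y, rfl⟩ := QuotientGroup.mk_surjective y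
      -- minimal element of the double coset of y⁻¹
      obtain ⟨⟨a, b⟩, hab⟩ : ∃ ab : ℤ × ℤ, ∀ cd : ℤ × ℤ,
          l (g ^ ab.1 * y⁻¹ * g ^ ab.2) ≤ l (g ^ cd.1 * y⁻¹ * g ^ cd.2) := by
        let f : ℤ × ℤ → ℕ := fun ab => (l (g ^ ab.1 * y⁻¹ * g ^ ab.2)).toNat
        refine ⟨Function.argmin f, fun cd => ?_⟩
        have h1 : f (Function.argmin f) ≤ f cd := Function.argmin_le f cd
        have h2 := h.nonneg (g ^ cd.1 * y⁻¹ * g ^ cd.2)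
        simp only [f] at h1 ⊢
        omega
      set s := g ^ a * y⁻¹ * g ^ b with hsdef
      have hsD : l s ≤ D := by
        refine h.comm_bound hg s (fun i => ?_) (fun i => ?_) (p s) (q s) (hq s) (he s)
        · have := hab (i + a, b)
          simpa [zpow_add, hsdef, mul_assoc] using this
        · have := hab (a, b + i)
          simpa [zpow_add, hsdef, mul_assoc] using this
      -- y⁻¹ = g^{-a} s g^{-b}
      set j := (-b) % (q s) with hj
      refine ⟨(s * g ^ j)⁻¹, ?_, ?_⟩
      · refine Set.mem_biUnion (show s ∈ {x | l x ≤ D} from hsD) ⟨j, ⟨?_, ?_⟩, rfl⟩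
        · exact Int.emod_nonneg _ (hq s)
        · exact (Int.emod_lt_abs _ (hq s)).le
      · simp only
        rw [QuotientGroup.eq, inv_inv]
        set m := (-b) / (q s) with hm
        have hb : -b = q s * m + j := (Int.mul_ediv_add_emod (-b) (q s)).symm
        have hcomm : s * g ^ (q s * m) = g ^ (p s * m) * s := by
          rw [zpow_mul g (p s), ← he s, conj_zpow, ← zpow_mul]; group
        have hy : y⁻¹ = g ^ (-a) * s * g ^ (-b) := by rw [hsdef]; group
        have hy2 : y⁻¹ = g ^ (-a + p s * m) * (s * g ^ j) := by
          rw [hy, hb, zpow_add, zpow_add, mul_assoc, ← mul_assoc s, hcomm]; group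
        have hy3 : s * g ^ j * y = g ^ (a - p s * m) := by
          have : y = (g ^ (-a + p s * m) * (s * g ^ j))⁻¹ := by rw [← hy2, inv_inv]
          rw [this]; group
        rw [hy3]
        exact Subgroup.zpow_mem_zpowers g _
    have : Finite (G ⧸ Subgroup.zpowers g) := by
      rw [← Set.finite_univ_iff]
      exact (hF.image _).subset fun y _ => hsurj y
    exact Subgroup.index_ne_zero_of_finite

/-! ### Free subgroups -/

/-- The value of a signed letter. -/
def letter (a : Fin 2 → G) (x : Fin 2 × Bool) : G := cond x.2 (a x.1) (a x.1)⁻¹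

lemma free_of_gp (h : HypLen l K) (a : Fin 2 → G) (c : ℤ)
    (hlen : ∀ x, c + K < l (letter a x))
    (hgp : ∀ x y, x ≠ y → gp l (letter a x) (letter a y) ≤ c) :
    Function.Injective (FreeGroup.lift a) := by
  have hK := h.K_nonneg
  have key : ∀ L : List (Fin 2 × Bool), FreeGroup.IsReduced L → ∀ x M, L = x :: M →
      0 < l (L.map (letter a)).prod ∧
      ∀ y, y ≠ x → gp l (letter a y) (L.map (letter a)).prod ≤ c + K := by
    intro L
    induction L with
    | nil => intro _ x M hx; simp at hx
    | cons x' L ih =>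
      rintro hred x M hx
      obtain ⟨rfl, rfl⟩ := List.cons.inj hx
      rw [List.map_cons, List.prod_cons]
      set W := (L.map (letter a)).prod with hW
      have hxx : letter a (x'.1, !x'.2) = (letter a x')⁻¹ := by
        rcases x' with ⟨i, _ | _⟩ <;> simp [letter]
      have hc0 : 0 ≤ c := (h.gp_nonneg _ _).trans (hgp x' (x'.1, !x'.2) (by
        rcases x' with ⟨i, _ | _⟩ <;> simp))
      have h1 : gp l (letter a x')⁻¹ W ≤ c + K ∧ 0 ≤ l W := by
        refine ⟨?_, h.nonneg _⟩
        cases L with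
        | nil => simp only [hW, List.map_nil, List.prod_nil, h.gp_one]; omega
        | cons z L =>
          rw [← hxx]
          refine (ih (hred.infix (List.suffix_cons _ _).isInfix) z L rfl).2 _ ?_
          rintro rfl
          have := (FreeGroup.isReduced_cons_cons.mp hred).1 rfl
          simp at this
      have h2 := h.len_mul (letter a x') W
      have h3 := hlen x'
      refine ⟨by omega, fun y hy => ?_⟩
      have h4 := h.gp_shift (letter a x') W
      have h5 := h.gp_four (letter a y) (letter a x' * W) (letter a x')
      have h6 := h.gp_symm (letter a x') (letter a x' * W)
      have h7 := hgp y x' hy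
      omega
  rw [injective_iff_map_eq_one]
  intro w hw
  by_contra hne
  have hne' : w.toWord ≠ [] := by rwa [Ne, FreeGroup.toWord_eq_nil_iff]
  obtain ⟨x, M, hxM⟩ := List.exists_cons_of_ne_nil hne'
  have := (key w.toWord FreeGroup.isReduced_toWord x M hxM).1
  have e : FreeGroup.lift a w = (w.toWord.map (letter a)).prod := by
    conv_lhs => rw [← FreeGroup.mk_toWord (x := w)]
    rw [FreeGroup.lift_mk]; rfl
  rw [← e, hw, h.one] at this
  omega

lemma free_of_noncomm (h : HypLen l K) {g : G} (hg : Lox l K g) (s : G)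
    (hs : ∀ p q : ℤ, s * g ^ q * s⁻¹ = g ^ p → q = 0) :
    ∃ f : FreeGroup (Fin 2) →* G, Function.Injective f := by
  have hK := h.K_nonneg
  obtain ⟨c, hc⟩ := h.bounded_of_noncomm hg s hs
  have hsn := h.nonneg s
  have h0 := h.gp_nonneg g g⁻¹
  have hc0 : 0 ≤ c := (h.gp_nonneg _ _).trans (hc 0 0)
  set C := c + gp l g g⁻¹ + 2 * K + 6 * l s with hC
  -- powers
  set N : ℕ := (C + K + 2 * l s + 1).toNat with hN
  have hNC : (N : ℤ) = C + K + 2 * l s + 1 := Int.toNat_of_nonneg (by omega)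
  have hpl : C + K + 2 * l s < l (g ^ N) := by
    have := h.lox_grow hg N
    omega
  have hconj : ∀ x, l x - 2 * l s ≤ l (s * x * s⁻¹) ∧ l (s * x * s⁻¹) ≤ l x + 2 * l s := by
    intro x
    have e1 := h.mul_le (s * x) s⁻¹
    have e2 := h.mul_le s x
    have e3 := h.inv s
    have e4 := h.mul_le s⁻¹ (s * x * s⁻¹ * s)
    have e5 := h.mul_le (s * x * s⁻¹) s
    have e6 : s⁻¹ * (s * x * s⁻¹ * s) = x := by group
    rw [e6] at e4
    omega
  have hcross : ∀ i j : ℤ, gp l (g ^ i) (s * g ^ j * s⁻¹) ≤ C := by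
    intro i j
    have e1 := h.gp_mul_right (g ^ i) (s * g ^ j) s⁻¹
    have e2 := h.inv s
    have e3 := hc i j
    omega
  have hgg : gp l (g ^ N) (g ^ N)⁻¹ ≤ gp l g g⁻¹ + 2 * K := by
    have e := h.lox_pow2 hg N N
    rw [h.gp_symm, ← inv_pow]; exact e
  have hbb : gp l (s * g ^ N * s⁻¹) (s * g ^ N * s⁻¹)⁻¹ ≤ C := by
    have e1 : (s * g ^ N * s⁻¹)⁻¹ = s * (g ^ N)⁻¹ * s⁻¹ := by group
    have e2 := hconj (g ^ N)
    have e3 := hconj (g ^ N)⁻¹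
    have e4 := hconj ((g ^ N)⁻¹ * (g ^ N)⁻¹)
    have e5 : (s * g ^ N * s⁻¹)⁻¹ * (s * (g ^ N)⁻¹ * s⁻¹)
      = s * ((g ^ N)⁻¹ * (g ^ N)⁻¹) * s⁻¹ := by group
    simp only [gp] at hgg hC ⊢
    rw [e1] at e5 ⊢
    rw [e5]
    omega
  refine ⟨_, h.free_of_gp ![g ^ N, s * g ^ N * s⁻¹] C ?_ ?_⟩
  · rintro ⟨i, b⟩
    have e2 := hconj (g ^ N)
    fin_cases i <;> cases b <;> simp only [letter, Fin.zero_eta, Fin.mk_one, Matrix.cons_val_zero,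
      Matrix.cons_val_one, cond_true, cond_false, h.inv] <;> omega
  · have p1 : g ^ N = g ^ (N : ℤ) := (zpow_natCast g N).symm
    have p2 : (g ^ N)⁻¹ = g ^ (-(N : ℤ)) := by rw [zpow_neg, zpow_natCast]
    have p3 : (s * g ^ N * s⁻¹)⁻¹ = s * g ^ (-(N : ℤ)) * s⁻¹ := by rw [← p2]; group
    have x1 : gp l (g ^ N) (s * g ^ N * s⁻¹) ≤ C := by rw [p1]; exact hcross _ _
    have x2 : gp l (g ^ N)⁻¹ (s * g ^ N * s⁻¹) ≤ C := by rw [p2, p1]; exact hcross _ _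
    have x3 : gp l (g ^ N) (s * g ^ N * s⁻¹)⁻¹ ≤ C := by rw [p3, p1]; exact hcross _ _
    have x4 : gp l (g ^ N)⁻¹ (s * g ^ N * s⁻¹)⁻¹ ≤ C := by rw [p3, p2]; exact hcross _ _
    have x5 : gp l (g ^ N) (g ^ N)⁻¹ ≤ C := by omega
    rintro ⟨i, b⟩ ⟨i', b'⟩ hne
    fin_cases i <;> fin_cases i' <;> cases b <;> cases b' <;>
      simp only [letter, Fin.zero_eta, Fin.mk_one, Matrix.cons_val_zero,
      Matrix.cons_val_one, cond_true, cond_false] <;>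
      first
      | exact absurd rfl hne
      | assumption
      | (rw [h.gp_symm]; assumption)

theorem main (h : HypLen l K)
    (hx : ∀ n : ℕ, ∃ x y, l x = n ∧ l y = n ∧ l (x⁻¹ * y) = 2 * n) (hNE : ¬ IsElementary G) :
    ∃ f : FreeGroup (Fin 2) →* G, Function.Injective f := by
  obtain ⟨g, hg⟩ := h.exists_lox hx
  by_contra hf
  apply hNE
  refine h.finite_index hg fun s => ?_
  by_contra hs
  push Not at hs
  exact hf (h.free_of_noncomm hg s hs)

end HypLen

/-! ### The word length -/

lemma exists_word {S : Set G} (hS : IsGenSet S) (g : G) :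
    ∃ w : List G, (∀ x ∈ w, x ∈ S) ∧ w.length = wordLength S g ∧ w.prod = g := by
  have hne : {n | ∃ w : List G, (∀ x ∈ w, x ∈ S) ∧ w.length = n ∧ w.prod = g}.Nonempty := by
    have hg : g ∈ Subgroup.closure S := by rw [hS.2.2]; trivial
    rw [← Subgroup.mem_toSubmonoid, Subgroup.closure_toSubmonoid] at hg
    obtain ⟨w, hw, he⟩ := Submonoid.exists_list_of_mem_closure hg
    refine ⟨w.length, w, fun x hx => ?_, rfl, he⟩
    rcases hw x hx with h | h
    · exact h
    · simpa using hS.2.1 _ h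
  exact Nat.sInf_mem hne

lemma wordLength_le {S : Set G} (w : List G) (hw : ∀ x ∈ w, x ∈ S) :
    wordLength S w.prod ≤ w.length := Nat.sInf_le ⟨w, hw, rfl, rfl⟩

lemma wordLength_one (S : Set G) : wordLength S (1 : G) = 0 := by
  have := wordLength_le (S := S) ([] : List G) (by simp)
  simpa using this

lemma wordLength_mul {S : Set G} (hS : IsGenSet S) (x y : G) :
    wordLength S (x * y) ≤ wordLength S x + wordLength S y := by
  obtain ⟨w, h1, h2, h3⟩ := exists_word hS x
  obtain ⟨w', h1', h2', h3'⟩ := exists_word hS y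
  have := wordLength_le (S := S) (w ++ w') (by
    intro z hz
    rcases List.mem_append.mp hz with h | h
    · exact h1 _ h
    · exact h1' _ h)
  rw [List.prod_append, h3, h3', List.length_append, h2, h2'] at this
  exact this

lemma wordLength_inv_le {S : Set G} (hS : IsGenSet S) (x : G) :
    wordLength S x⁻¹ ≤ wordLength S x := by
  obtain ⟨w, h1, h2, h3⟩ := exists_word hS x
  have := wordLength_le (S := S) (w.map (fun x => x⁻¹)).reverse (by
    intro z hz
    simp only [List.mem_reverse, List.mem_map] at hz
    obtain ⟨y, hy, rfl⟩ := hz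
    exact hS.2.1 _ (h1 _ hy))
  rw [← List.prod_inv_reverse, h3] at this
  simpa [h2] using this

lemma wordLength_inv {S : Set G} (hS : IsGenSet S) (x : G) :
    wordLength S x⁻¹ = wordLength S x := by
  refine le_antisymm (wordLength_inv_le hS x) ?_
  have := wordLength_inv_le hS x⁻¹
  rwa [inv_inv] at this

lemma wordLength_ball {S : Set G} (hS : IsGenSet S) (n : ℕ) :
    {x | wordLength S x ≤ n}.Finite := by
  have key : ∀ n : ℕ, {g : G | ∃ w : List G, (∀ x ∈ w, x ∈ S) ∧ w.length = n ∧ w.prod = g}.Finite := by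
    intro n
    induction n with
    | zero =>
      refine (Set.finite_singleton (1 : G)).subset ?_
      rintro g ⟨w, _, h2, h3⟩
      rw [List.length_eq_zero_iff] at h2
      subst h2
      simpa using h3.symm
    | succ n ih =>
      refine (Set.Finite.image2 (fun a b => a * b) hS.1 ih).subset ?_
      rintro g ⟨w, h1, h2, h3⟩
      cases w with
      | nil => simp at h2
      | cons a w =>
        refine ⟨a, h1 a (by simp), w.prod, ⟨w, fun x hx => h1 x (by simp [hx]), by simpa using h2, rfl⟩, ?_⟩
        simpa using h3
  refine ((Set.finite_Iic n).biUnion fun m _ => key m).subset ?_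
  intro g hg
  exact Set.mem_biUnion (show wordLength S g ∈ Set.Iic n from hg) (exists_word hS g)

lemma exists_geodesic {S : Set G} (hS : IsGenSet S) (x y : G) :
    ∃ γ : ℕ → G, IsGeodesicSegment S γ (wordDist S x y) ∧ γ 0 = x ∧ γ (wordDist S x y) = y := by
  obtain ⟨w, h1, h2, h3⟩ := exists_word hS (x⁻¹ * y)
  have key : ∀ i j, i ≤ j → j ≤ w.length →
      wordLength S ((w.take i).prod⁻¹ * (w.take j).prod) = j - i := by
    intro i j hij hj
    have e1 : (w.take i).prod⁻¹ * (w.take j).prod = ((w.drop i).take (j - i)).prod := by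
      rw [inv_mul_eq_iff_eq_mul, ← List.prod_append, ← List.take_add]
      congr 2; omega
    have e2 : w.prod = (w.take i).prod * ((w.take i).prod⁻¹ * (w.take j).prod) * (w.drop j).prod := by
      rw [mul_inv_cancel_left, ← List.prod_append, List.take_append_drop]
    have l1 := wordLength_le (S := S) (w.take i) fun x hx => h1 x (List.mem_of_mem_take hx)
    have l2 := wordLength_le (S := S) ((w.drop i).take (j - i))
      fun x hx => h1 x (List.mem_of_mem_drop (List.mem_of_mem_take hx))
    have l3 := wordLength_le (S := S) (w.drop j) fun x hx => h1 x (List.mem_of_mem_drop hx)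
    have l4 := wordLength_mul hS ((w.take i).prod * ((w.take i).prod⁻¹ * (w.take j).prod)) (w.drop j).prod
    have l5 := wordLength_mul hS (w.take i).prod ((w.take i).prod⁻¹ * (w.take j).prod)
    rw [← e2, h3, ← h2] at l4
    rw [← e1] at l2
    simp only [List.length_take, List.length_drop] at l1 l2 l3
    omega
  refine ⟨fun i => x * (w.take i).prod, ?_, by simp, ?_⟩
  · intro i j hi hj
    have hw : wordDist S x y = w.length := h2.symm
    rw [hw] at hi hj
    have e : (x * (w.take i).prod)⁻¹ * (x * (w.take j).prod) = (w.take i).prod⁻¹ * (w.take j).prod := by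
      group
    simp only [wordDist, e]
    rcases le_total i j with hij | hij
    · rw [key i j hij hj, Nat.dist_eq_sub_of_le hij]
    · rw [← wordLength_inv hS, mul_inv_rev, inv_inv, key j i hij hi, Nat.dist_eq_sub_of_le_right hij]
  · have hw : wordDist S x y = w.length := h2.symm
    simp only [hw, List.take_length, h3]; group

lemma wordDist_triangle {S : Set G} (hS : IsGenSet S) (x y z : G) :
    wordDist S x z ≤ wordDist S x y + wordDist S y z := by
  have := wordLength_mul hS (x⁻¹ * y) (y⁻¹ * z)
  have e : x⁻¹ * y * (y⁻¹ * z) = x⁻¹ * z := by group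
  rwa [e] at this

lemma wordDist_comm {S : Set G} (hS : IsGenSet S) (x y : G) :
    wordDist S x y = wordDist S y x := by
  have := wordLength_inv hS (x⁻¹ * y)
  rw [mul_inv_rev, inv_inv] at this
  exact this.symm

lemma near_geodesic {S : Set G} (hS : IsGenSet S) {γ : ℕ → G} {n : ℕ} (hγ : IsGeodesicSegment S γ n)
    {p : G} {i δ : ℕ} (hi : i ≤ n) (hp : wordDist S p (γ i) ≤ δ) :
    wordDist S (γ 0) p + wordDist S p (γ n) ≤ wordDist S (γ 0) (γ n) + 2 * δ := by
  have a1 := hγ 0 i (by omega) hi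
  have a2 := hγ i n hi le_rfl
  have a3 := hγ 0 n (by omega) le_rfl
  rw [Nat.dist_eq_sub_of_le (by omega)] at a1 a2 a3
  have b1 := wordDist_triangle hS (γ 0) (γ i) p
  have b2 := wordDist_triangle hS p (γ i) (γ n)
  have b3 := wordDist_comm hS p (γ i)
  omega

/-- Thin triangles, in terms of distances. -/
lemma thin {S : Set G} (hS : IsGenSet S) {δ : ℕ} (hδ : IsDeltaHyperbolic S δ) (x y z : G)
    (γ : ℕ → G) (n : ℕ) (hγ : IsGeodesicSegment S γ n) (h0 : γ 0 = x) (hn : γ n = z) (k : ℕ) (hk : k ≤ n) :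
    wordDist S x (γ k) + wordDist S (γ k) y ≤ wordDist S x y + 2 * δ ∨
    wordDist S y (γ k) + wordDist S (γ k) z ≤ wordDist S y z + 2 * δ := by
  obtain ⟨γ₁, g1, s1, t1⟩ := exists_geodesic hS x y
  obtain ⟨γ₂, g2, s2, t2⟩ := exists_geodesic hS y z
  obtain ⟨i, ⟨hi, hd⟩ | ⟨hi, hd⟩⟩ := hδ γ₁ γ₂ γ _ _ n g1 g2 hγ (by rw [s1, h0]) (by rw [t1, s2])
    (by rw [t2, hn]) k hk
  · left
    have := near_geodesic hS g1 hi hd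
    rwa [s1, t1] at this
  · right
    have := near_geodesic hS g2 hi hd
    rwa [s2, t2] at this

lemma four_point {S : Set G} (hS : IsGenSet S) {δ : ℕ} (hδ : IsDeltaHyperbolic S δ) (x y z w : G) :
    wordDist S x z + wordDist S y w ≤ max (wordDist S x y + wordDist S z w)
      (wordDist S y z + wordDist S x w) + (4 * δ + 2) := by
  obtain ⟨γ, hγ, h0, hn⟩ := exists_geodesic hS x z
  set n := wordDist S x z with hndef
  -- a center of the triangle x y z
  have center : ∃ k ≤ n, wordDist S x (γ k) + wordDist S (γ k) y ≤ wordDist S x y + 2 * δ + 2 ∧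
      wordDist S y (γ k) + wordDist S (γ k) z ≤ wordDist S y z + 2 * δ + 2 := by
    by_contra hc
    push Not at hc
    have hA : ∀ k ≤ n, wordDist S x (γ k) + wordDist S (γ k) y ≤ wordDist S x y + 2 * δ := by
      intro k
      induction k with
      | zero =>
        intro _
        have : wordDist S x x = 0 := by simp [wordDist, wordLength_one]
        rw [h0, this]; omega
      | succ k ih =>
        intro hk
        have i1 := ih (by omega)
        have i2 := hc k (by omega) (by omega)
        rcases thin hS hδ x y z γ n hγ h0 hn (k + 1) hk with h | h
        · exact h
        · exfalso
          have d := hγ k (k + 1) (by omega) hk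
          rw [Nat.dist_eq_sub_of_le (by omega)] at d
          have t1 := wordDist_triangle hS y (γ (k + 1)) (γ k)
          have t2 := wordDist_triangle hS (γ k) (γ (k + 1)) z
          have t3 := wordDist_comm hS (γ (k + 1)) (γ k)
          omega
    have h1 := hc n le_rfl (by have := hA n le_rfl; omega)
    have : wordDist S z z = 0 := by simp [wordDist, wordLength_one]
    rw [hn, this] at h1
    omega
  obtain ⟨k, hk, c1, c2⟩ := center
  have t := wordDist_triangle hS x (γ k) z
  have t' := wordDist_triangle hS y (γ k) w
  have s1 := wordDist_comm hS (γ k) y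
  have s2 := wordDist_comm hS (γ k) w
  have s3 := wordDist_comm hS z w
  rcases thin hS hδ x w z γ n hγ h0 hn k hk with h | h <;> omega

lemma hypLen_of_hyperbolic {S : Set G} (hS : IsGenSet S) {δ : ℕ} (hδ : IsDeltaHyperbolic S δ) :
    HypLen (fun g : G => (wordLength S g : ℤ)) (4 * δ + 2) where
  K_nonneg := by positivity
  one := by simp [wordLength_one]
  inv x := by simp [wordLength_inv hS]
  mul_le x y := by exact_mod_cast wordLength_mul hS x y
  nonneg x := by positivity
  four x y z w := by exact_mod_cast four_point hS hδ x y z w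
  ball R := by
    refine (wordLength_ball hS R.toNat).subset fun x hx => ?_
    simp only [Set.mem_ofPred_eq] at hx ⊢
    omega

lemma exists_flat {S : Set G} (hS : IsGenSet S) [Infinite G] (n : ℕ) :
    ∃ x y : G, wordLength S x = n ∧ wordLength S y = n ∧ wordLength S (x⁻¹ * y) = 2 * n := by
  obtain ⟨g, hg⟩ := (wordLength_ball hS (2 * n)).exists_notMem
  simp only [Set.mem_ofPred_eq, not_le] at hg
  obtain ⟨γ, hγ, h0, hn⟩ := exists_geodesic hS 1 g
  have e : wordDist S 1 g = wordLength S g := by simp [wordDist]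
  rw [e] at hγ
  have a1 := hγ n 0 (by omega) (by omega)
  have a2 := hγ n (2 * n) (by omega) (by omega)
  have a3 := hγ 0 (2 * n) (by omega) (by omega)
  refine ⟨(γ n)⁻¹ * γ 0, (γ n)⁻¹ * γ (2 * n), ?_, ?_, ?_⟩
  · simpa [wordDist, Nat.dist] using a1
  · rw [Nat.dist_eq_sub_of_le (by omega)] at a2
    simp only [wordDist] at a2; omega
  · rw [Nat.dist_eq_sub_of_le (by omega)] at a3
    have : ((γ n)⁻¹ * γ 0)⁻¹ * ((γ n)⁻¹ * γ (2 * n)) = (γ 0)⁻¹ * γ (2 * n) := by group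
    rw [this]
    simp only [wordDist] at a3; omega

end Helpers

/-- A non-elementary hyperbolic group contains a free subgroup of
rank 2. -/
theorem statement_19 {G : Type*} [Group G] (S : Set G) (hGen : IsGenSet S)
    (hHyp : IsHyperbolic S) (hNE : ¬ IsElementary G) :
    ∃ f : FreeGroup (Fin 2) →* G, Function.Injective f := by
  obtain ⟨δ, hδ⟩ := hHyp
  have hinf : Infinite G := by
    rw [← not_finite_iff_infinite]
    exact fun hf => hNE (Or.inl hf)
  refine (hypLen_of_hyperbolic hGen hδ).main (fun n => ?_) hNE
  obtain ⟨x, y, h1, h2, h3⟩ := exists_flat hGen n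
  exact ⟨x, y, by exact_mod_cast h1, by exact_mod_cast h2, by exact_mod_cast h3⟩
end
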